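/- arXiv:1609.09046 — 3 statements merged into one kernel-verified Lean document; each statement's English description precedes it below -/
import Mathlib

section
/- Fix n ≥ 2. For every R > 0, the integral over the closed Euclidean ball B(0,R) ⊆ EuclideanSpace ℝ (Fin n) satisfies ∫_{B(0,R)} (1 / Real.cosh (x 0)) dx = |B^{n-1}(1)| · R^{n-1} · (π - 2(n-1)·F_{n-1}(R)), where |B^{n-1}(1)| is the Lebesgue volume of the unit ball of ℝ^{n-1} and F_{n-1}(R) = ∫₀^{π/2} 2·Real.arctan (Real.exp (-R·cos θ)) · (sin θ)^{n-2} · (cos θ) dθ. -/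
open Real Set MeasureTheory
lemma sech_deriv (R θ : ℝ) : HasDerivAt (fun θ => 2 * Real.arctan (Real.exp (-R * Real.cos θ)))
    (R * Real.sin θ * (1 / Real.cosh (-R * Real.cos θ))) θ := by
  have h1 : HasDerivAt (fun θ => -R * Real.cos θ) (-R * -Real.sin θ) θ :=
    (Real.hasDerivAt_cos θ).const_mul _
  have h := (h1.exp.arctan).const_mul 2
  refine h.congr_deriv ?_
  generalize -R * Real.cos θ = u
  rw [Real.cosh_eq, Real.exp_neg]
  have := Real.exp_pos u
  field_simp
  ring

lemma one_dim (k : ℕ) (R : ℝ) (hR : 0 < R) :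
    (∫ a in (-R)..R, 1 / Real.cosh a * Real.sqrt (R ^ 2 - a ^ 2) ^ (k + 1)) =
      R ^ (k + 1) * (π - 2 * (k + 1 : ℝ) * (∫ θ in (0 : ℝ)..(π / 2),
                2 * Real.arctan (Real.exp (-R * Real.cos θ)) * Real.sin θ ^ k *
                  Real.cos θ)) := by
  set g : ℝ → ℝ := fun a => 1 / Real.cosh a * Real.sqrt (R ^ 2 - a ^ 2) ^ (k + 1) with hg
  have hgc : Continuous g := by
    have : ∀ x, Real.cosh x ≠ 0 := fun x => (Real.cosh_pos x).ne'
    have := Real.continuous_cosh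
    fun_prop (disch := assumption)
  have heven : (∫ a in (0:ℝ)..R, g a) = ∫ a in (-R)..0, g a := by
    have := intervalIntegral.integral_comp_neg (a := 0) (b := R) g
    rw [neg_zero] at this
    rw [← this]
    simp [hg]
  rw [← intervalIntegral.integral_add_adjacent_intervals (hgc.intervalIntegrable (-R) 0)
    (hgc.intervalIntegrable 0 R), heven]
  have hsub := intervalIntegral.integral_comp_mul_deriv (a := 0) (b := π / 2)
    (f := fun θ => -R * Real.cos θ) (f' := fun θ => -R * -Real.sin θ) (g := g)
    (fun θ _ => (Real.hasDerivAt_cos θ).const_mul _) (by fun_prop) hgc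
  simp only [Real.cos_zero, Real.cos_pi_div_two, mul_one, mul_zero] at hsub
  rw [← hsub]
  have hibp := intervalIntegral.integral_deriv_mul_eq_sub (a := 0) (b := π / 2)
    (u := fun θ => 2 * Real.arctan (Real.exp (-R * Real.cos θ)))
    (u' := fun θ => R * Real.sin θ * (1 / Real.cosh (-R * Real.cos θ)))
    (v := fun θ => Real.sin θ ^ (k+1))
    (v' := fun θ => ((k + 1 : ℕ) : ℝ) * Real.sin θ ^ k * Real.cos θ)
    (fun θ _ => sech_deriv R θ)
    (fun θ _ => by simpa using (Real.hasDerivAt_sin θ).fun_pow (k+1))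
    (by
      apply Continuous.intervalIntegrable
      have : ∀ x, Real.cosh (-R * Real.cos x) ≠ 0 := fun x => (Real.cosh_pos _).ne'
      have := Real.continuous_cosh
      fun_prop (disch := assumption))
    (by apply Continuous.intervalIntegrable; fun_prop)
  have hc1 : Continuous (fun θ => R * Real.sin θ * (1 / Real.cosh (-R * Real.cos θ)) * Real.sin θ ^ (k+1)) := by
      have : ∀ x, Real.cosh (-R * Real.cos x) ≠ 0 := fun x => (Real.cosh_pos _).ne'
      have := Real.continuous_cosh
      fun_prop (disch := assumption)
  have hc2 : Continuous (fun θ => 2 * Real.arctan (Real.exp (-R * Real.cos θ)) * (((k + 1 : ℕ) : ℝ) * Real.sin θ ^ k * Real.cos θ)) := by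
    have := Real.continuous_arctan
    fun_prop
  rw [intervalIntegral.integral_add (hc1.intervalIntegrable _ _) (hc2.intervalIntegrable _ _)] at hibp
  have e1 : (∫ θ in (0:ℝ)..(π/2), (g ∘ fun θ => -R * Real.cos θ) θ * (-R * -Real.sin θ)) =
     R ^ (k+1) * ∫ θ in (0:ℝ)..(π/2), R * Real.sin θ * (1 / Real.cosh (-R * Real.cos θ)) * Real.sin θ ^ (k+1) := by
    rw [← intervalIntegral.integral_const_mul]
    apply intervalIntegral.integral_congr
    intro θ hθ
    rw [uIcc_of_le (by positivity)] at hθ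
    have hs : 0 ≤ Real.sin θ := Real.sin_nonneg_of_nonneg_of_le_pi hθ.1 (by linarith [hθ.2, Real.pi_pos])
    have : Real.sqrt (R ^ 2 - (-R * Real.cos θ) ^ 2) = R * Real.sin θ := by
      rw [show R ^ 2 - (-R * Real.cos θ) ^ 2 = (R * Real.sin θ)^2 by
        rw [mul_pow R, Real.sin_sq]; ring]
      exact Real.sqrt_sq (by positivity)
    simp only [hg, Function.comp, this]
    ring
  have e2 : (∫ θ in (0:ℝ)..(π/2), 2 * Real.arctan (Real.exp (-R * Real.cos θ)) * (((k + 1 : ℕ) : ℝ) * Real.sin θ ^ k * Real.cos θ))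
     = (k+1) * ∫ θ in (0:ℝ)..(π/2), 2 * Real.arctan (Real.exp (-R * Real.cos θ)) * Real.sin θ ^ k * Real.cos θ := by
    rw [← intervalIntegral.integral_const_mul]
    congr 1; ext θ; push_cast; ring
  rw [e2] at hibp
  rw [e1]
  simp at hibp ⊢
  linear_combination (2 * R^(k+1)) * hibp

lemma slice_vol (m : ℕ) (s : ℝ) (hs : 0 ≤ s) :
    (volume {v : Fin m → ℝ | ∑ i, v i ^ 2 ≤ s}).toReal =
      (volume (Metric.ball (0 : EuclideanSpace ℝ (Fin m)) 1)).toReal * Real.sqrt s ^ m := by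
  have h := (PiLp.volume_preserving_toLp (Fin m)).measure_preimage
    (s := Metric.closedBall 0 (Real.sqrt s)) Metric.isClosed_closedBall.measurableSet.nullMeasurableSet
  have h2 : {v : Fin m → ℝ | ∑ i, v i ^ 2 ≤ s} =
      (@WithLp.toLp 2 (Fin m → ℝ)) ⁻¹' Metric.closedBall 0 (Real.sqrt s) := by
    ext v
    simp [EuclideanSpace.norm_eq]
    rw [Real.sqrt_le_sqrt_iff hs]
  rw [h2, h, Measure.addHaar_closedBall _ _ (Real.sqrt_nonneg s)]
  simp [mul_comm]

lemma slice (m : ℕ) (R : ℝ) (hR : 0 < R) :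
    (∫ x in Metric.closedBall (0 : EuclideanSpace ℝ (Fin (m + 1))) R, 1 / Real.cosh (x 0)) =
      (volume (Metric.ball (0 : EuclideanSpace ℝ (Fin m)) 1)).toReal *
        ∫ a in (-R)..R, 1 / Real.cosh a * Real.sqrt (R ^ 2 - a ^ 2) ^ m := by
  set S : Set (ℝ × (Fin m → ℝ)) := {p | p.1 ^ 2 + ∑ i, p.2 i ^ 2 ≤ R ^ 2} with hS
  have hSm : MeasurableSet S := by
    apply IsClosed.measurableSet
    apply isClosed_le <;> fun_prop
  have hT := (volume_preserving_piFinSuccAbove (fun _ : Fin (m + 1) => ℝ) 0).comp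
    (PiLp.volume_preserving_ofLp (Fin (m + 1)))
  set T := (MeasurableEquiv.piFinSuccAbove (fun _ : Fin (m + 1) => ℝ) 0) ∘
    (@WithLp.ofLp 2 (Fin (m + 1) → ℝ)) with hTdef
  have hTe : MeasurableEmbedding T :=
    (MeasurableEquiv.measurableEmbedding _).comp
      (MeasurableEquiv.toLp 2 (Fin (m + 1) → ℝ)).symm.measurableEmbedding
  have hT1 : ∀ x, (T x).1 = x 0 := fun x => rfl
  have hT2 : ∀ x i, (T x).2 i = x i.succ := fun x i => rfl
  have hpre : Metric.closedBall (0 : EuclideanSpace ℝ (Fin (m + 1))) R = T ⁻¹' S := by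
    ext x
    simp only [hS, mem_closedBall_zero_iff, mem_preimage, mem_ofPred_eq, hT1, hT2]
    rw [EuclideanSpace.norm_eq, Real.sqrt_le_left hR.le, Fin.sum_univ_succ]
    simp
  have hcc : ∀ x, Real.cosh x ≠ 0 := fun x => (Real.cosh_pos x).ne'
  have hint0 : IntegrableOn (fun x : EuclideanSpace ℝ (Fin (m + 1)) => 1 / Real.cosh (x 0))
      (Metric.closedBall 0 R) := by
    apply ContinuousOn.integrableOn_compact (isCompact_closedBall _ _)
    apply Continuous.continuousOn
    have := Real.continuous_cosh
    exact continuous_const.div (by fun_prop) (fun x => hcc _)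
  have hint : IntegrableOn (fun p : ℝ × (Fin m → ℝ) => 1 / Real.cosh p.1) S := by
    rw [hpre] at hint0
    exact (hT.integrableOn_comp_preimage hTe (f := fun p : ℝ × (Fin m → ℝ) => 1 / Real.cosh p.1)).1 hint0
  have h1 : (∫ x in Metric.closedBall (0 : EuclideanSpace ℝ (Fin (m + 1))) R, 1 / Real.cosh (x 0)) =
      ∫ p in S, 1 / Real.cosh p.1 := by
    rw [hpre]
    exact hT.setIntegral_preimage_emb hTe (fun p : ℝ × (Fin m → ℝ) => 1 / Real.cosh p.1) S
  rw [h1, ← integral_indicator hSm]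
  rw [← integrable_indicator_iff hSm] at hint
  rw [Measure.volume_eq_prod] at hint ⊢
  rw [integral_prod _ hint]
  have h2 : ∀ a : ℝ, (∫ v : Fin m → ℝ, S.indicator (fun p => 1 / Real.cosh p.1) (a, v)) =
      (Icc (-R) R).indicator (fun a => (volume (Metric.ball (0 : EuclideanSpace ℝ (Fin m)) 1)).toReal *
        (1 / Real.cosh a * Real.sqrt (R ^ 2 - a ^ 2) ^ m)) a := by
    intro a
    have e : (fun v : Fin m → ℝ => S.indicator (fun p => 1 / Real.cosh p.1) (a, v)) =
        {v : Fin m → ℝ | ∑ i, v i ^ 2 ≤ R ^ 2 - a ^ 2}.indicator (fun _ => 1 / Real.cosh a) := by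
      ext v
      simp only [indicator, hS, mem_ofPred_eq, le_sub_iff_add_le, add_comm]
    have hm : MeasurableSet {v : Fin m → ℝ | ∑ i, v i ^ 2 ≤ R ^ 2 - a ^ 2} := by
      apply IsClosed.measurableSet
      apply isClosed_le <;> fun_prop
    rw [e, integral_indicator_const _ hm, measureReal_def]
    by_cases ha : a ∈ Icc (-R) R
    · rw [indicator_of_mem ha, slice_vol _ _ (by nlinarith [ha.1, ha.2]), smul_eq_mul]
      ring
    · rw [indicator_of_notMem ha]
      have : {v : Fin m → ℝ | ∑ i, v i ^ 2 ≤ R ^ 2 - a ^ 2} = ∅ := by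
        ext v
        simp only [mem_ofPred_eq, mem_empty_iff_false, iff_false, not_le]
        have h0 : 0 ≤ ∑ i, v i ^ 2 := by positivity
        have : R ^ 2 < a ^ 2 := by
          rw [mem_Icc, ← abs_le, not_le] at ha
          exact sq_lt_sq.2 (by rwa [abs_of_pos hR])
        linarith
      simp [this]
  simp_rw [h2]
  rw [integral_indicator measurableSet_Icc, integral_Icc_eq_integral_Ioc,
    ← intervalIntegral.integral_of_le (by linarith), intervalIntegral.integral_const_mul]



/-- The total weighted extrinsic curvature of the grim hyperplane over the geodesic ball,
in flat arclength coordinates: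
`∫_{B(0,R)} sech(x₀) dx = |B^{n-1}(1)| R^{n-1} (π - 2(n-1) F_{n-1}(R))`, where
`F_{n-1}(R) = ∫₀^{π/2} 2 arctan (e^{-R cos θ}) sin^{n-2}θ cos θ dθ`. -/
theorem ball_integral_sech (n : ℕ) (hn : 2 ≤ n) :
    ∀ R : ℝ, 0 < R →
      (∫ x in Metric.closedBall (0 : EuclideanSpace ℝ (Fin n)) R,
          1 / Real.cosh (x ⟨0, by omega⟩))
        = (volume (Metric.ball (0 : EuclideanSpace ℝ (Fin (n - 1))) 1)).toReal *
            R ^ (n - 1) *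
            (π - 2 * (n - 1 : ℝ) *
              (∫ θ in (0 : ℝ)..(π / 2),
                2 * Real.arctan (Real.exp (-R * Real.cos θ)) * Real.sin θ ^ (n - 2) *
                  Real.cos θ)) := by
  obtain ⟨k, rfl⟩ : ∃ k, n = k + 2 := ⟨n - 2, by omega⟩
  intro R hR
  have h1 := slice (k + 1) R hR
  rw [one_dim k R hR, ← mul_assoc] at h1
  have h2 : ((k + 2 : ℕ) : ℝ) - 1 = k + 1 := by push_cast; ring
  rw [h2]
  exact h1
end

section
/- Fix n ≥ 2. Then (1/R^{n-1}) · ∫_{B(0,R) ⊆ EuclideanSpace ℝ (Fin n)} (1 / Real.cosh (x 0)) dx tends to π · |B^{n-1}(1)| as R tends to +∞, where |B^{n-1}(1)| is the Lebesgue volume of the unit ball of ℝ^{n-1}. -/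
open Real Set MeasureTheory Filter

lemma aux_deriv (x : ℝ) : HasDerivAt (fun t => Real.arctan (Real.sinh t)) (1 / Real.cosh x) x := by
  have h := (Real.hasDerivAt_sinh x).arctan
  convert h using 1
  have h1 := Real.cosh_sq x
  have h2 := Real.cosh_pos x
  rw [show 1 + Real.sinh x ^ 2 = Real.cosh x ^ 2 by linarith]
  field_simp

lemma aux_top : Tendsto (fun t => Real.arctan (Real.sinh t)) atTop (nhds (π / 2)) := by
  have h : Tendsto Real.sinh atTop atTop := by
    refine tendsto_atTop_mono' _ ?_ tendsto_id
    filter_upwards [eventually_ge_atTop 0] with x hx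
    exact Real.self_le_sinh_iff.2 hx
  exact (Real.tendsto_arctan_atTop.mono_right nhdsWithin_le_nhds).comp h

lemma aux_bot : Tendsto (fun t => Real.arctan (Real.sinh t)) atBot (nhds (-(π / 2))) := by
  have h := (aux_top.comp tendsto_neg_atBot_atTop).neg
  refine h.congr fun x => ?_
  simp [Real.sinh_neg, Real.arctan_neg]

lemma aux_int : Integrable (fun t : ℝ => 1 / Real.cosh t) := by
  have h1 : IntegrableOn (fun t : ℝ => 1 / Real.cosh t) (Ioi 0) :=
    integrableOn_Ioi_deriv_of_nonneg' (fun x _ => aux_deriv x)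
      (fun x _ => by have := Real.cosh_pos x; positivity) aux_top
  have h2 : IntegrableOn (fun t : ℝ => 1 / Real.cosh t) (Iic 0) := by
    have h3 := ((integrableOn_Ici_iff_integrableOn_Ioi (by simp)).2 h1).comp_neg
    simpa using h3
  rw [← integrableOn_univ, ← Iic_union_Ioi (a := (0 : ℝ))]
  exact h2.union h1

lemma aux_val : ∫ t : ℝ, 1 / Real.cosh t = π := by
  rw [integral_of_hasDerivAt_of_tendsto aux_deriv aux_int aux_bot aux_top]
  ring

/-- Splitting off the zeroth coordinate. -/
noncomputable def auxEquiv (m : ℕ) :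
    EuclideanSpace ℝ (Fin (m + 1)) ≃ᵐ ℝ × EuclideanSpace ℝ (Fin m) :=
  ((MeasurableEquiv.toLp 2 (Fin (m + 1) → ℝ)).symm.trans
    (MeasurableEquiv.piFinSuccAbove (fun _ : Fin (m + 1) => ℝ) 0)).trans
    ((MeasurableEquiv.refl ℝ).prodCongr (MeasurableEquiv.toLp 2 (Fin m → ℝ)))

lemma auxEquiv_mp (m : ℕ) : MeasurePreserving (auxEquiv m) := by
  have h1 := PiLp.volume_preserving_ofLp (Fin (m + 1))
  have h2 := volume_preserving_piFinSuccAbove (fun _ : Fin (m + 1) => ℝ) 0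
  have h3 := (MeasurePreserving.id (volume : Measure ℝ)).prod (PiLp.volume_preserving_toLp (Fin m))
  exact h3.comp (h2.comp h1)

lemma auxEquiv_fst (m : ℕ) (x) : (auxEquiv m x).1 = x 0 := rfl

lemma auxEquiv_norm (m : ℕ) (x) : ‖x‖ ^ 2 = (auxEquiv m x).1 ^ 2 + ‖(auxEquiv m x).2‖ ^ 2 := by
  rw [EuclideanSpace.real_norm_sq_eq, EuclideanSpace.real_norm_sq_eq, Fin.sum_univ_succ]
  rfl

lemma aux_slice (m : ℕ) (hm : 1 ≤ m) (R t : ℝ) :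
    (volume : Measure (EuclideanSpace ℝ (Fin m))).real {y | t ^ 2 + ‖y‖ ^ 2 ≤ R ^ 2} =
      Real.sqrt (R ^ 2 - t ^ 2) ^ m *
        (volume (Metric.ball (0 : EuclideanSpace ℝ (Fin m)) 1)).toReal := by
  by_cases h : t ^ 2 ≤ R ^ 2
  · have : {y : EuclideanSpace ℝ (Fin m) | t ^ 2 + ‖y‖ ^ 2 ≤ R ^ 2} =
        Metric.closedBall 0 (Real.sqrt (R ^ 2 - t ^ 2)) := by
      ext y
      rw [mem_closedBall_zero_iff, Real.le_sqrt (norm_nonneg _) (by linarith), mem_ofPred_eq]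
      constructor <;> intro <;> linarith
    rw [this, Measure.addHaar_real_closedBall _ _ (Real.sqrt_nonneg _)]
    simp [Measure.real]
  · have : {y : EuclideanSpace ℝ (Fin m) | t ^ 2 + ‖y‖ ^ 2 ≤ R ^ 2} = ∅ := by
      ext y
      simp only [mem_ofPred_eq, mem_empty_iff_false, iff_false]
      nlinarith [sq_nonneg ‖y‖]
    rw [this, Real.sqrt_eq_zero_of_nonpos (by linarith), zero_pow (by omega)]
    simp

lemma aux_main (m : ℕ) (hm : 1 ≤ m) (R : ℝ) (hR : 0 < R) :
    (∫ x in Metric.closedBall (0 : EuclideanSpace ℝ (Fin (m + 1))) R, 1 / Real.cosh (x 0)) =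
      ∫ t : ℝ, 1 / Real.cosh t * (Real.sqrt (R ^ 2 - t ^ 2) ^ m *
        (volume (Metric.ball (0 : EuclideanSpace ℝ (Fin m)) 1)).toReal) := by
  set S : Set (ℝ × EuclideanSpace ℝ (Fin m)) := {p | p.1 ^ 2 + ‖p.2‖ ^ 2 ≤ R ^ 2} with hS
  have hSm : MeasurableSet S := measurableSet_le (by fun_prop) (by fun_prop)
  have hpre : Metric.closedBall (0 : EuclideanSpace ℝ (Fin (m + 1))) R = auxEquiv m ⁻¹' S := by
    ext x
    rw [mem_closedBall_zero_iff, mem_preimage, hS, mem_ofPred_eq, ← auxEquiv_norm,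
      sq_le_sq₀ (norm_nonneg _) hR.le]
  have hIntOn : IntegrableOn (fun x : EuclideanSpace ℝ (Fin (m + 1)) => 1 / Real.cosh (x 0))
      (Metric.closedBall 0 R) := by
    refine ContinuousOn.integrableOn_compact (isCompact_closedBall _ _) ?_
    refine Continuous.continuousOn ?_
    exact continuous_const.div (Real.continuous_cosh.comp (by fun_prop))
      fun x => (Real.cosh_pos _).ne'
  have hIntOn' : IntegrableOn (fun p : ℝ × EuclideanSpace ℝ (Fin m) => 1 / Real.cosh p.1) S := by
    rw [← (auxEquiv_mp m).integrableOn_comp_preimage (auxEquiv m).measurableEmbedding, ← hpre]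
    exact hIntOn
  have h1 := (auxEquiv_mp m).setIntegral_preimage_emb (auxEquiv m).measurableEmbedding
    (fun p : ℝ × EuclideanSpace ℝ (Fin m) => 1 / Real.cosh p.1) S
  rw [hpre]
  refine h1.trans ?_
  rw [← integral_indicator hSm]
  rw [Measure.volume_eq_prod, integral_prod]
  swap
  · exact (integrable_indicator_iff hSm).2 hIntOn'
  congr 1
  ext t
  rw [← aux_slice m hm]
  have : (fun y => S.indicator (fun p : ℝ × EuclideanSpace ℝ (Fin m) => 1 / Real.cosh p.1) (t, y)) =
      ({y | t ^ 2 + ‖y‖ ^ 2 ≤ R ^ 2} : Set (EuclideanSpace ℝ (Fin m))).indicator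
        (fun _ => 1 / Real.cosh t) := by
    ext y
    simp only [indicator, hS, mem_ofPred_eq]
  rw [this, integral_indicator_const _ (measurableSet_le (by fun_prop) (by fun_prop)), smul_eq_mul,
    mul_comm]

/-- Proposition 1 in Euclidean coordinates: the normalized total weighted extrinsic curvature
of the grim hyperplane tends to `π |B^{n-1}(1)|`:
`R^{-(n-1)} ∫_{B(0,R)} sech(x₀) dx → π |B^{n-1}(1)|` as `R → ∞`. -/
theorem normalized_total_curvature_limit (n : ℕ) (hn : 2 ≤ n) :
    Filter.Tendsto
      (fun R : ℝ => (1 / R ^ (n - 1)) *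
        ∫ x in Metric.closedBall (0 : EuclideanSpace ℝ (Fin n)) R,
          1 / Real.cosh (x ⟨0, by omega⟩))
      Filter.atTop
      (nhds (π * (volume (Metric.ball (0 : EuclideanSpace ℝ (Fin (n - 1))) 1)).toReal)) := by
  obtain ⟨m, rfl⟩ : ∃ m, n = m + 1 := ⟨n - 1, by omega⟩
  have hm : 1 ≤ m := by omega
  simp only [Nat.add_sub_cancel]
  set c := (volume (Metric.ball (0 : EuclideanSpace ℝ (Fin m)) 1)).toReal with hc
  have hc0 : 0 ≤ c := ENNReal.toReal_nonneg
  have key : Tendsto (fun R : ℝ => ∫ t : ℝ, 1 / Real.cosh t *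
      (Real.sqrt (1 - (t / R) ^ 2) ^ m * c)) atTop (nhds (∫ t : ℝ, 1 / Real.cosh t * c)) := by
    refine tendsto_integral_filter_of_dominated_convergence (fun t => 1 / Real.cosh t * c)
      ?_ ?_ (aux_int.mul_const c) ?_
    · refine Eventually.of_forall fun R => ?_
      refine Measurable.aestronglyMeasurable ?_
      have := Real.continuous_cosh.measurable
      fun_prop
    · refine Eventually.of_forall fun R => Eventually.of_forall fun t => ?_
      have h1 : 0 ≤ 1 / Real.cosh t := by have := Real.cosh_pos t; positivity
      have h2 : Real.sqrt (1 - (t / R) ^ 2) ≤ 1 := by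
        rw [Real.sqrt_le_iff]
        exact ⟨zero_le_one, by linarith [sq_nonneg (t / R)]⟩
      have h3 : Real.sqrt (1 - (t / R) ^ 2) ^ m ≤ 1 := pow_le_one₀ (Real.sqrt_nonneg _) h2
      rw [Real.norm_of_nonneg (by positivity)]
      exact mul_le_mul_of_nonneg_left (mul_le_of_le_one_left hc0 h3) h1
    · refine Eventually.of_forall fun t => ?_
      have h1 : Tendsto (fun R : ℝ => t / R) atTop (nhds 0) := tendsto_const_nhds.div_atTop tendsto_id
      have h2 : Continuous fun u : ℝ => 1 / Real.cosh t * (Real.sqrt (1 - u ^ 2) ^ m * c) := by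
        fun_prop
      have h3 := (h2.tendsto 0).comp h1
      simpa [Function.comp_def] using h3
  rw [integral_mul_const, aux_val] at key
  refine key.congr' ?_
  filter_upwards [eventually_gt_atTop 0] with R hR
  have h := aux_main m hm R hR
  rw [show (⟨0, by omega⟩ : Fin (m + 1)) = 0 from rfl, h, ← integral_const_mul]
  congr 1
  ext t
  have : Real.sqrt (R ^ 2 - t ^ 2) = R * Real.sqrt (1 - (t / R) ^ 2) := by
    rw [show R ^ 2 - t ^ 2 = R ^ 2 * (1 - (t / R) ^ 2) by field_simp,
      Real.sqrt_mul (sq_nonneg R), Real.sqrt_sq hR.le]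
  rw [this, mul_pow, ← hc]
  have := Real.cosh_pos t
  field_simp
end

section
/- Let n = 2 or n = 3. There exists a constant C > 0 such that for all R ≥ 1, ∫_{B(0,R) ⊆ EuclideanSpace ℝ (Fin n)} (1 / Real.cosh (x 0)) dx ≤ C · R². -/
open Real Set MeasureTheory

lemma aux_sech_le (t : ℝ) : 1 / Real.cosh t ≤ 4 * (1 + t ^ 2)⁻¹ := by
  have h1 := Real.quadratic_le_exp_of_nonneg (abs_nonneg t)
  have h2 := Real.add_one_le_exp (-|t|)
  have h3 := Real.cosh_eq |t|
  rw [Real.cosh_abs] at h3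
  rw [sq_abs] at h1
  have h4 : 1 + t ^ 2 ≤ 4 * Real.cosh t := by
    rw [h3]; linarith
  rw [← div_eq_mul_inv, div_le_div_iff₀ (Real.cosh_pos t) (by positivity)]
  linarith

lemma aux_general (m : ℕ) (R : ℝ) (hR : 0 ≤ R) :
    (∫ x in Metric.closedBall (0 : EuclideanSpace ℝ (Fin (m + 1))) R,
          1 / Real.cosh (x 0)) ≤ 4 * π * (2 * R) ^ m := by
  let g : Fin (m + 1) → ℝ → ℝ :=
    Fin.cons (fun t => 4 * (1 + t ^ 2)⁻¹) (fun _ => (Icc (-R) R).indicator (fun _ => 1))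
  have hg : ∀ i, Integrable (g i) := by
    intro i
    refine Fin.cases ?_ (fun j => ?_) i
    · exact integrable_inv_one_add_sq.const_mul 4
    · simp only [g, Fin.cons_succ]
      exact (integrable_indicator_iff measurableSet_Icc).2 (by simp)
  have hF : Integrable (fun y : Fin (m + 1) → ℝ => ∏ i, g i (y i)) :=
    Integrable.fintype_prod hg
  have hmp := EuclideanSpace.volume_preserving_symm_measurableEquiv_toLp (Fin (m + 1))
  have hint : ∫ x : EuclideanSpace ℝ (Fin (m + 1)), ∏ i, g i (x i) = 4 * π * (2 * R) ^ m := by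
    have := hmp.integral_comp' (fun y : Fin (m + 1) → ℝ => ∏ i, g i (y i))
    refine this.trans ?_
    rw [integral_fintype_prod_volume_eq_prod, Fin.prod_univ_succ]
    simp only [g, Fin.cons_zero, Fin.cons_succ]
    rw [integral_const_mul, integral_univ_inv_one_add_sq, integral_indicator measurableSet_Icc]
    simp [Measure.real, ENNReal.toReal_ofReal, hR, two_mul]
  rw [← hint, ← integral_indicator Metric.isClosed_closedBall.measurableSet]
  refine integral_mono_of_nonneg (.of_forall fun x => ?_)
    (hmp.integrable_comp_of_integrable hF) (.of_forall fun x => ?_)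
  · exact indicator_nonneg (fun x _ => by have := Real.cosh_pos (x 0); positivity) x
  · have hpos : 0 ≤ ∏ i, g i (x i) := by
      refine Finset.prod_nonneg fun i _ => ?_
      refine Fin.cases ?_ (fun j => ?_) i
      · simp only [g, Fin.cons_zero]; positivity
      · simp only [g, Fin.cons_succ]; exact indicator_nonneg (fun _ _ => zero_le_one) _
    by_cases hx : x ∈ Metric.closedBall (0 : EuclideanSpace ℝ (Fin (m + 1))) R
    · simp only [indicator_of_mem hx, Fin.prod_univ_succ, g, Fin.cons_zero, Fin.cons_succ]
      rw [Finset.prod_eq_one, mul_one]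
      · exact aux_sech_le _
      · intro j _
        apply indicator_of_mem
        have h1 := PiLp.norm_apply_le x j.succ
        rw [mem_closedBall_zero_iff] at hx
        exact abs_le.1 (h1.trans hx)
    · simp only [indicator_of_notMem hx]; exact hpos



/-- Quadratic growth of the total weighted extrinsic curvature of the grim hyperplane for
`n = 2, 3`: there is `C > 0` with `∫_{B(0,R)} sech(x₀) dx ≤ C R²` for all `R ≥ 1`. -/
theorem total_curvature_quadratic_growth (n : ℕ) (hn : n = 2 ∨ n = 3) :
    ∃ C : ℝ, 0 < C ∧ ∀ R : ℝ, 1 ≤ R →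
      (∫ x in Metric.closedBall (0 : EuclideanSpace ℝ (Fin n)) R,
          1 / Real.cosh (x ⟨0, by omega⟩))
        ≤ C * R ^ 2 := by

  refine ⟨16 * π, by positivity, fun R hR => ?_⟩
  have h0 : 0 ≤ R := by linarith
  have hp := Real.pi_pos
  rcases hn with rfl | rfl
  · refine (aux_general 1 R h0).trans ?_
    have : R ≤ R ^ 2 := by nlinarith
    nlinarith [mul_le_mul_of_nonneg_left this hp.le, mul_nonneg hp.le (sq_nonneg R)]
  · refine (aux_general 2 R h0).trans (le_of_eq ?_)
    ring
end
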